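/- Assume the kinetic semigroup definitions. For every Schwartz function f : ℝ^{2d} → ℝ, the function u(t,x,v) := P_t f(x,v) = ∫_{ℝ^{2d}} f(x+tv+y, v+w)·p_t(y,w) dy dw satisfies the kinetic Fokker–Planck (Kolmogorov) equation: for every t > 0 and every (x,v) ∈ ℝ^{2d}, the partial derivative ∂_t u(t,x,v) exists, u(t,·,·) is twice differentiable in v and differentiable in x, and ∂_t u(t,x,v) = Δ_v u(t,x,v) + v·∇_x u(t,x,v), where Δ_v u := Σ_{i=1}^d ∂²u/∂v_i² and v·∇_x u := Σ_{i=1}^d v_i·∂u/∂x_i. -/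

import Mathlib

open Real MeasureTheory ENNReal Set

noncomputable section

/-- `ℝ^d` (velocity / position component). -/
abbrev KV (d : ℕ) := EuclideanSpace ℝ (Fin d)

/-- The phase space `ℝ^{2d}` with points `z = (x, v)`. -/
abbrev KSpace (d : ℕ) := KV d × KV d

variable {d : ℕ}

/-- The kinetic anisotropic quasi-norm `|z|_θ = |x|^{1/3} + |v|` (anisotropy `θ = (3,1)`). -/
def kNorm (z : KSpace d) : ℝ := ‖z.1‖ ^ ((1 : ℝ) / 3) + ‖z.2‖

/-- The anisotropic dilation `(2^{-3j} ξ, 2^{-j} η)`. -/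
def kDilate (j : ℕ) (z : KSpace d) : KSpace d :=
  ((2 : ℝ) ^ (-(3 : ℝ) * (j : ℝ)) • z.1, (2 : ℝ) ^ (-(j : ℝ)) • z.2)

/-- `φ_0` is a smooth symmetric nonnegative cutoff adapted to `|·|_θ`:
`φ_0 = 1` on `B^θ_1` and `φ_0 = 0` outside `B^θ_2`. -/
structure IsKineticCutoff (φ0 : KSpace d → ℝ) : Prop where
  smooth : ContDiff ℝ (⊤ : ℕ∞) φ0
  nonneg : ∀ z, 0 ≤ φ0 z
  symm : ∀ z, φ0 (-z) = φ0 z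
  eq_one : ∀ z, kNorm z ≤ 1 → φ0 z = 1
  eq_zero : ∀ z, ¬ kNorm z ≤ 2 → φ0 z = 0

/-- The kinetic Littlewood–Paley functions `φ_j`. -/
def kLP (φ0 : KSpace d → ℝ) : ℕ → KSpace d → ℝ
  | 0 => φ0
  | (j + 1) => fun z => φ0 (kDilate (j + 1) z) - φ0 (kDilate j z)

/-- Euclidean pairing on the phase space. -/
def kDot (z w : KSpace d) : ℝ := (∑ a, z.1 a * w.1 a) + ∑ a, z.2 a * w.2 a

/-- Real form of the inverse Fourier transform `φ̌` of a symmetric real function. -/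
def kCheck (φ : KSpace d → ℝ) (z : KSpace d) : ℝ :=
  ∫ ξ, φ ξ * Real.cos (2 * π * kDot z ξ)

variable {F : Type*} [NormedAddCommGroup F] [NormedSpace ℝ F]

/-- The Littlewood–Paley block `R_j f = φ̌_j * f`. -/
def kBlock (φ0 : KSpace d → ℝ) (j : ℕ) (f : KSpace d → F) (z : KSpace d) : F :=
  ∫ y, kCheck (kLP φ0 j) y • f (z - y)

/-- The kinetic anisotropic Besov norm `‖f‖_{B^s_{p;θ}} = sup_{j≥0} 2^{sj}‖R_j f‖_{L^p}`,
valued in `[0,∞]`. -/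
def kBesov (φ0 : KSpace d → ℝ) (s : ℝ) (p : ℝ≥0∞) (f : KSpace d → F) : ℝ≥0∞ :=
  ⨆ j : ℕ, ENNReal.ofReal ((2 : ℝ) ^ (s * (j : ℝ))) * eLpNorm (kBlock φ0 j f) p volume

/-- The kinetic heat kernel
`p_t(x,v) = (2π t⁴/3)^{−d/2} exp(−(3|x|² + |3x−2tv|²)/(4t³))`. -/
def heatKer (d : ℕ) (t : ℝ) (z : KSpace d) : ℝ :=
  (2 * π * t ^ 4 / 3) ^ (-(d : ℝ) / 2) *
    Real.exp (-(3 * ‖z.1‖ ^ 2 + ‖(3 : ℝ) • z.1 - (2 * t) • z.2‖ ^ 2) / (4 * t ^ 3))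

/-- The transport operator `Γ_t f(x,v) = f(x+tv, v)`. -/
def kGamma (t : ℝ) (f : KSpace d → F) (z : KSpace d) : F := f (z.1 + t • z.2, z.2)

/-- The kinetic semigroup `P_t f(x,v) = ∫ f(x+tv+y, v+w) p_t(y,w) dy dw`, `P_0 f = f`. -/
def kSemigroup (t : ℝ) (f : KSpace d → F) : KSpace d → F :=
  if t = 0 then f
  else fun z => ∫ w : KSpace d, heatKer d t w • f (z.1 + t • z.2 + w.1, z.2 + w.2)

open scoped Topology RealInnerProductSpace

instance isAddHaarMeasure_volume_kSpace :
    (volume : Measure (KSpace d)).IsAddHaarMeasure :=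
  inferInstanceAs ((volume : Measure (KV d)).prod (volume : Measure (KV d))).IsAddHaarMeasure

/-- The negative of the quadratic form in the exponent of the kinetic heat kernel. -/
def heatPhase (t : ℝ) (z : KSpace d) : ℝ :=
  (3 * ‖z.1‖ ^ 2 + ‖(3 : ℝ) • z.1 - (2 * t) • z.2‖ ^ 2) / (4 * t ^ 3)

/-- The normalising factor of the kinetic heat kernel. -/
def heatCoef (d : ℕ) (t : ℝ) : ℝ := (2 * π * t ^ 4 / 3) ^ (-(d : ℝ) / 2)

/-- The logarithmic gradient of the kernel `p_t (w - Γ_t z)` in the position of `z`. -/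
def xSlope (t : ℝ) (z : KSpace d) : KV d := (6 / t ^ 3) • z.1 - (3 / t ^ 2) • z.2

/-- The logarithmic gradient of the kernel `p_t (w - Γ_t z)` in the velocity of `z`. -/
def vSlope (t : ℝ) (z : KSpace d) : KV d := (3 / t ^ 2) • z.1 - (1 / t) • z.2

/-- The displacement from the free transport of `(x, v)` at time `t` to the point `w`. -/
def kShift (t : ℝ) (x v : KV d) (w : KSpace d) : KSpace d := (w.1 - (x + t • v), w.2 - v)

theorem heatKer_eq (t : ℝ) (z : KSpace d) :
    heatKer d t z = heatCoef d t * Real.exp (-heatPhase t z) := by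
  rw [heatKer, heatCoef, heatPhase, neg_div (4 * t ^ 3)]

theorem heatCoef_pos {t : ℝ} (ht : 0 < t) : 0 < heatCoef d t := by
  unfold heatCoef; positivity

theorem heatKer_pos {t : ℝ} (ht : 0 < t) (z : KSpace d) : 0 < heatKer d t z := by
  rw [heatKer_eq]; exact mul_pos (heatCoef_pos ht) (Real.exp_pos _)

theorem heatCoef_anti {s t : ℝ} (hs : 0 < s) (hst : s ≤ t) : heatCoef d t ≤ heatCoef d s := by
  unfold heatCoef
  apply Real.rpow_le_rpow_of_nonpos (by positivity) (by gcongr)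
  have : (0 : ℝ) ≤ d := Nat.cast_nonneg d
  linarith

theorem norm_sq_smul_sub_smul (a b : ℝ) (x y : KV d) :
    ‖a • x - b • y‖ ^ 2 = a ^ 2 * ‖x‖ ^ 2 - 2 * a * b * ⟪x, y⟫ + b ^ 2 * ‖y‖ ^ 2 := by
  rw [norm_sub_sq_real, norm_smul, norm_smul, real_inner_smul_left, real_inner_smul_right,
    mul_pow, mul_pow, Real.norm_eq_abs, Real.norm_eq_abs, sq_abs, sq_abs]
  ring

theorem heatPhase_expand {t : ℝ} (ht : 0 < t) (z : KSpace d) :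
    heatPhase t z =
      3 / t ^ 3 * ‖z.1‖ ^ 2 - 3 / t ^ 2 * ⟪z.1, z.2⟫ + 1 / t * ‖z.2‖ ^ 2 := by
  rw [heatPhase, norm_sq_smul_sub_smul]
  field_simp
  ring

theorem heatPhase_nonneg {t : ℝ} (ht : 0 < t) (z : KSpace d) : 0 ≤ heatPhase t z := by
  unfold heatPhase; positivity

theorem norm_vSlope_sq_le {t : ℝ} (ht : 0 < t) (z : KSpace d) :
    ‖vSlope t z‖ ^ 2 ≤ 4 / t * heatPhase t z := by
  have h := sq_nonneg ‖(1 / t) • z.1 - (1 : ℝ) • z.2‖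
  rw [norm_sq_smul_sub_smul] at h
  have key : 4 / t * heatPhase t z - ‖vSlope t z‖ ^ 2 = 3 / t ^ 2 *
      ((1 / t) ^ 2 * ‖z.1‖ ^ 2 - 2 * (1 / t) * 1 * ⟪z.1, z.2⟫ + 1 ^ 2 * ‖z.2‖ ^ 2) := by
    rw [heatPhase_expand ht, vSlope, norm_sq_smul_sub_smul]
    field_simp
    ring
  have := mul_nonneg (by positivity : 0 ≤ 3 / t ^ 2) h
  linarith

theorem norm_xSlope_sq_le {t : ℝ} (ht : 0 < t) (z : KSpace d) :
    ‖xSlope t z‖ ^ 2 ≤ 12 / t ^ 3 * heatPhase t z := by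
  have key : 12 / t ^ 3 * heatPhase t z - ‖xSlope t z‖ ^ 2 = 3 / t ^ 4 * ‖z.2‖ ^ 2 := by
    rw [heatPhase_expand ht, xSlope, norm_sq_smul_sub_smul]
    field_simp
    ring
  have : 0 ≤ 3 / t ^ 4 * ‖z.2‖ ^ 2 := by positivity
  linarith

theorem mul_exp_neg_le_one (q : ℝ) : q * Real.exp (-q) ≤ 1 := by
  rw [Real.exp_neg, ← div_eq_mul_inv, div_le_one (Real.exp_pos _)]
  linarith [Real.add_one_le_exp q]

theorem heatKer_le {t : ℝ} (ht : 0 < t) (z : KSpace d) : heatKer d t z ≤ heatCoef d t := by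
  rw [heatKer_eq]
  refine mul_le_of_le_one_right (heatCoef_pos ht).le ?_
  simpa using heatPhase_nonneg ht z

theorem heatKer_mul_heatPhase_le {t : ℝ} (ht : 0 < t) (z : KSpace d) :
    heatKer d t z * heatPhase t z ≤ heatCoef d t := by
  rw [heatKer_eq, mul_assoc, mul_comm (Real.exp _)]
  exact mul_le_of_le_one_right (heatCoef_pos ht).le (mul_exp_neg_le_one _)

theorem heatKer_mul_norm_vSlope_sq_le {t : ℝ} (ht : 0 < t) (z : KSpace d) :
    heatKer d t z * ‖vSlope t z‖ ^ 2 ≤ heatCoef d t * (4 / t) := by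
  have h1 := mul_le_mul_of_nonneg_left (norm_vSlope_sq_le ht z) (heatKer_pos ht z).le
  have h2 := mul_le_mul_of_nonneg_right (heatKer_mul_heatPhase_le ht z)
    (by positivity : 0 ≤ 4 / t)
  linarith

theorem heatKer_mul_norm_vSlope_le {t : ℝ} (ht : 0 < t) (z : KSpace d) :
    heatKer d t z * ‖vSlope t z‖ ≤ heatCoef d t * (1 + 4 / t) := by
  have h1 : ‖vSlope t z‖ ≤ 1 + ‖vSlope t z‖ ^ 2 := by nlinarith [sq_nonneg (‖vSlope t z‖ - 1)]
  have h2 := mul_le_mul_of_nonneg_left h1 (heatKer_pos ht z).le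
  linarith [heatKer_le ht z, heatKer_mul_norm_vSlope_sq_le ht z]

theorem heatKer_mul_norm_xSlope_le {t : ℝ} (ht : 0 < t) (z : KSpace d) :
    heatKer d t z * ‖xSlope t z‖ ≤ heatCoef d t * (1 + 12 / t ^ 3) := by
  have h1 : ‖xSlope t z‖ ≤ 1 + ‖xSlope t z‖ ^ 2 := by nlinarith [sq_nonneg (‖xSlope t z‖ - 1)]
  have h2 := mul_le_mul_of_nonneg_left (h1.trans (add_le_add_right (norm_xSlope_sq_le ht z) 1))
    (heatKer_pos ht z).le
  have h3 := mul_le_mul_of_nonneg_right (heatKer_mul_heatPhase_le ht z)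
    (by positivity : 0 ≤ 12 / t ^ 3)
  linarith [heatKer_le ht z]

theorem continuous_heatKer (t : ℝ) : Continuous (heatKer d t) := by
  unfold heatKer; fun_prop

theorem continuous_xSlope (t : ℝ) : Continuous (xSlope (d := d) t) := by
  unfold xSlope; fun_prop

theorem continuous_vSlope (t : ℝ) : Continuous (vSlope (d := d) t) := by
  unfold vSlope; fun_prop

theorem continuous_kShift (t : ℝ) (x v : KV d) : Continuous (kShift t x v) := by
  unfold kShift; fun_prop

/-- The kinetic semigroup as an integral with all parameters in the kernel. -/
theorem kSemigroup_eq {t : ℝ} (ht : 0 < t) (f : KSpace d → ℝ) (x v : KV d) :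
    kSemigroup t f (x, v) = ∫ w, f w • heatKer d t (kShift t x v w) := by
  rw [kSemigroup, if_neg ht.ne', ← integral_add_right_eq_self
    (fun w => f w • heatKer d t (kShift t x v w)) ((x + t • v, v) : KSpace d)]
  refine integral_congr_ae (.of_forall fun w => ?_)
  simp [kShift, add_comm, mul_comm, Prod.add_def]

theorem hasFDerivAt_heatKer {t : ℝ} (ht : 0 < t) (z : KSpace d) :
    HasFDerivAt (heatKer d t)
      (heatKer d t z • (-(innerSL ℝ (xSlope t z)).comp (ContinuousLinearMap.fst ℝ (KV d) (KV d)) +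
        (innerSL ℝ ((3 / t ^ 2) • z.1 - (2 / t) • z.2)).comp
          (ContinuousLinearMap.snd ℝ (KV d) (KV d)))) z := by
  have h1 : HasFDerivAt (fun z : KSpace d => z.1) (ContinuousLinearMap.fst ℝ _ _) z :=
    hasFDerivAt_fst
  have h2 : HasFDerivAt (fun z : KSpace d => z.2) (ContinuousLinearMap.snd ℝ _ _) z :=
    hasFDerivAt_snd
  have hq := (((h1.norm_sq.const_mul 3).add
    (((h1.const_smul (3 : ℝ)).sub (h2.const_smul (2 * t))).norm_sq)).neg.mul_const
      ((4 * t ^ 3)⁻¹)).exp.const_mul (heatCoef d t)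
  refine HasFDerivAt.congr_fderiv (f := heatKer d t) hq ?_
  refine ContinuousLinearMap.ext fun h => ?_
  simp [heatKer, heatCoef, xSlope, div_eq_mul_inv]
  field_simp
  ring

theorem hasFDerivAt_heatKer_position {t : ℝ} (ht : 0 < t) (x v : KV d) (w : KSpace d) :
    HasFDerivAt (fun x' => heatKer d t (kShift t x' v w))
      (heatKer d t (kShift t x v w) • innerSL ℝ (xSlope t (kShift t x v w))) x := by
  have hs : HasFDerivAt (fun x' => kShift t x' v w)
      ((-ContinuousLinearMap.id ℝ (KV d)).prod 0) x :=
    (((hasFDerivAt_id x).add_const _).const_sub _).prodMk (hasFDerivAt_const _ _)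
  refine ((hasFDerivAt_heatKer ht _).comp x hs).congr_fderiv ?_
  refine ContinuousLinearMap.ext fun h => ?_
  simp

theorem hasFDerivAt_kShift_velocity (t : ℝ) (x v : KV d) (w : KSpace d) :
    HasFDerivAt (fun v' => kShift t x v' w)
      ((-(t • ContinuousLinearMap.id ℝ (KV d))).prod (-ContinuousLinearMap.id ℝ (KV d))) v :=
  ((((hasFDerivAt_id v).const_smul t).const_add x).const_sub _).prodMk
    ((hasFDerivAt_id v).const_sub _)

theorem hasFDerivAt_heatKer_velocity {t : ℝ} (ht : 0 < t) (x v : KV d) (w : KSpace d) :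
    HasFDerivAt (fun v' => heatKer d t (kShift t x v' w))
      (heatKer d t (kShift t x v w) • innerSL ℝ (vSlope t (kShift t x v w))) v := by
  refine ((hasFDerivAt_heatKer ht _).comp v
    (hasFDerivAt_kShift_velocity t x v w)).congr_fderiv ?_
  refine ContinuousLinearMap.ext fun h => ?_
  simp [xSlope, vSlope, inner_smul_right]
  field_simp
  ring

section SlopeForm

variable (V : Type*) [NormedAddCommGroup V] [InnerProductSpace ℝ V]

/-- Continuous bilinear forms on a real inner product space. -/
abbrev BilinForm := V →L[ℝ] V →L[ℝ] ℝ

instance normSMulClass_bilinForm : NormSMulClass ℝ (BilinForm V) :=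
  @NormedSpace.toNormSMulClass ℝ (BilinForm V) _ _ _

/-- The real inner product as a continuous bilinear form. -/
def innerCLM : BilinForm V :=
  LinearMap.mkContinuous₂ (innerₗ V) 1 fun x y => by simpa using norm_inner_le_norm (𝕜 := ℝ) x y

variable {V}

@[simp]
theorem innerCLM_apply (x y : V) : innerCLM V x y = ⟪x, y⟫ := rfl

/-- The bilinear form `(h, k) ↦ ⟪q, h⟫ * ⟪q, k⟫ - c * ⟪h, k⟫`. -/
def slopeForm (c : ℝ) (q : V) : BilinForm V :=
  (innerSL ℝ q).smulRight (innerSL ℝ q) - c • innerCLM V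

theorem slopeForm_apply (c : ℝ) (q h k : V) :
    slopeForm c q h k = ⟪q, h⟫ * ⟪q, k⟫ - c * ⟪h, k⟫ := by
  simp [slopeForm]

theorem norm_slopeForm_le {c : ℝ} (hc : 0 ≤ c) (q : V) :
    ‖slopeForm c q‖ ≤ ‖q‖ ^ 2 + c * ‖innerCLM V‖ := by
  refine (norm_sub_le ((innerSL ℝ q).smulRight (innerSL ℝ q) : BilinForm V)
    (c • innerCLM V)).trans_eq ?_
  rw [ContinuousLinearMap.norm_smulRight_apply, innerSL_apply_norm, norm_smul,
    Real.norm_of_nonneg hc, sq]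

theorem continuous_slopeForm (c : ℝ) : Continuous (slopeForm c : V → BilinForm V) := by
  have h := (innerSL ℝ : V →L⋆[ℝ] V →L[ℝ] ℝ).continuous
  exact ((ContinuousLinearMap.smulRightL ℝ V (V →L[ℝ] ℝ)).continuous₂.comp
    (h.prodMk h)).sub continuous_const

end SlopeForm

/-- The second velocity derivative of the kernel `p_t (w - Γ_t z)`, as a function of
`ζ = w - Γ_t z`. -/
def heatKerHess (t : ℝ) (ζ : KSpace d) : BilinForm (KV d) :=
  heatKer d t ζ • slopeForm (2 / t) (vSlope t ζ)

theorem hasFDerivAt_heatKer_velocity_two {t : ℝ} (ht : 0 < t) (x v : KV d) (w : KSpace d) :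
    HasFDerivAt
      (fun v' => heatKer d t (kShift t x v' w) • innerSL ℝ (vSlope t (kShift t x v' w)))
      (heatKerHess t (kShift t x v w)) v := by
  have hs := hasFDerivAt_kShift_velocity t x v w
  have hv : HasFDerivAt (fun v' => vSlope t (kShift t x v' w))
      (-(2 / t) • ContinuousLinearMap.id ℝ (KV d)) v := by
    refine ((hs.fst.const_smul (3 / t ^ 2)).sub (hs.snd.const_smul (1 / t))).congr_fderiv ?_
    refine ContinuousLinearMap.ext fun h => ?_
    ext i
    simp
    field_simp
    ring
  have hi : HasFDerivAt (fun v' => innerSL ℝ (vSlope t (kShift t x v' w)))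
      ((innerCLM (KV d)).comp (-(2 / t) • ContinuousLinearMap.id ℝ (KV d))) v :=
    (innerCLM (KV d)).hasFDerivAt.comp v hv
  refine ((hasFDerivAt_heatKer_velocity ht x v w).smul hi).congr_fderiv ?_
  refine ContinuousLinearMap.ext fun h => ContinuousLinearMap.ext fun k => ?_
  simp [heatKerHess, slopeForm_apply]
  ring

theorem hasDerivAt_heatCoef {t : ℝ} (ht : 0 < t) :
    HasDerivAt (heatCoef d) (heatCoef d t * (-(2 * d) / t)) t := by
  have h := (((hasDerivAt_pow 4 t).const_mul (2 * π)).div_const 3).rpow_const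
    (p := -(d : ℝ) / 2) (Or.inl (by positivity))
  refine HasDerivAt.congr_deriv (f := heatCoef d) h ?_
  rw [heatCoef, Real.rpow_sub_one (by positivity)]
  simp
  field_simp
  ring

theorem hasDerivAt_heatKer_time {t : ℝ} (ht : 0 < t) (x v : KV d) (w : KSpace d) :
    HasDerivAt (fun τ => heatKer d τ (kShift τ x v w))
      (heatKer d t (kShift t x v w) * (‖vSlope t (kShift t x v w)‖ ^ 2 - 2 * d / t +
        ⟪xSlope t (kShift t x v w), v⟫)) t := by
  have ha : HasDerivAt (fun τ => w.1 - (x + τ • v)) (-v) t := by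
    simpa using (((hasDerivAt_id t).smul_const v).const_add x).const_sub w.1
  have hb : HasDerivAt (fun τ : ℝ => (2 * τ) • (w.2 - v)) ((2 : ℝ) • (w.2 - v)) t := by
    simpa using ((hasDerivAt_id t).const_mul 2).smul_const (w.2 - v)
  have hq := (((ha.norm_sq.const_mul 3).add
    (((ha.const_smul (3 : ℝ)).sub hb).norm_sq)).neg.div
      ((hasDerivAt_pow 3 t).const_mul 4) (by positivity)).exp
  refine HasDerivAt.congr_deriv (f := fun τ => heatKer d τ (kShift τ x v w))
    ((hasDerivAt_heatCoef (d := d) ht).mul hq) ?_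
  rw [vSlope, norm_sq_smul_sub_smul]
  simp only [Pi.add_apply, Pi.sub_apply, Pi.neg_apply, Pi.smul_apply, Pi.div_apply]
  simp only [heatKer_eq, heatPhase, heatCoef, kShift, xSlope, norm_sq_smul_sub_smul,
    neg_div (4 * t ^ 3)]
  generalize w.1 - (x + t • v) = a
  generalize w.2 - v = b
  simp only [inner_sub_left, inner_sub_right, real_inner_smul_left, inner_smul_right,
    inner_neg_right, real_inner_self_eq_norm_sq]
  field_simp
  ring

section Integrals

variable {H E : Type*} [NormedAddCommGroup H] [NormedSpace ℝ H] [NormedAddCommGroup E]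
  [NormedSpace ℝ E] {φ : KSpace d → ℝ}

theorem integrable_smul_of_bounded (hφ : Integrable φ) {K : KSpace d → E} (hK : Continuous K)
    {C : ℝ} (hC : ∀ w, ‖K w‖ ≤ C) : Integrable fun w => φ w • K w := by
  refine (hφ.norm.mul_const C).mono' (hφ.aestronglyMeasurable.smul hK.aestronglyMeasurable)
    (.of_forall fun w => ?_)
  rw [norm_smul]
  exact mul_le_mul_of_nonneg_left (hC w) (norm_nonneg _)

theorem hasFDerivAt_integral_smul_of_bounded (hφ : Integrable φ) {K : H → KSpace d → E}
    {K' : H → KSpace d → H →L[ℝ] E} {s₀ : H} {C C' : ℝ} (hK : ∀ s, Continuous (K s))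
    (hC : ∀ w, ‖K s₀ w‖ ≤ C) (hK' : Continuous (K' s₀)) (hC' : ∀ s w, ‖K' s w‖ ≤ C')
    (h : ∀ s w, HasFDerivAt (fun s' => K s' w) (K' s w) s) :
    HasFDerivAt (fun s => ∫ w, φ w • K s w) (∫ w, φ w • K' s₀ w) s₀ := by
  refine hasFDerivAt_integral_of_dominated_of_fderiv_le (bound := fun w => ‖φ w‖ * C')
    Filter.univ_mem
    (.of_forall fun s => hφ.aestronglyMeasurable.smul (hK s).aestronglyMeasurable)
    (integrable_smul_of_bounded hφ (hK s₀) hC)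
    (hφ.aestronglyMeasurable.smul hK'.aestronglyMeasurable)
    (.of_forall fun w s _ => ?_) (hφ.norm.mul_const C')
    (.of_forall fun w s _ => (h s w).const_smul (φ w))
  rw [norm_smul]
  exact mul_le_mul_of_nonneg_left (hC' s w) (norm_nonneg _)

end Integrals

theorem norm_heatKer_le {t : ℝ} (ht : 0 < t) (z : KSpace d) :
    ‖heatKer d t z‖ ≤ heatCoef d t := by
  rw [Real.norm_of_nonneg (heatKer_pos ht z).le]
  exact heatKer_le ht z

theorem norm_heatKer_smul_xSlope_le {t : ℝ} (ht : 0 < t) (z : KSpace d) :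
    ‖heatKer d t z • innerSL ℝ (xSlope t z)‖ ≤ heatCoef d t * (1 + 12 / t ^ 3) := by
  rw [norm_smul, Real.norm_of_nonneg (heatKer_pos ht z).le, innerSL_apply_norm]
  exact heatKer_mul_norm_xSlope_le ht z

theorem norm_heatKer_smul_vSlope_le {t : ℝ} (ht : 0 < t) (z : KSpace d) :
    ‖heatKer d t z • innerSL ℝ (vSlope t z)‖ ≤ heatCoef d t * (1 + 4 / t) := by
  rw [norm_smul, Real.norm_of_nonneg (heatKer_pos ht z).le, innerSL_apply_norm]
  exact heatKer_mul_norm_vSlope_le ht z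

theorem norm_heatKerHess_le {t : ℝ} (ht : 0 < t) (z : KSpace d) :
    ‖heatKerHess t z‖ ≤ heatCoef d t * (4 / t + 2 / t * ‖innerCLM (KV d)‖) := by
  rw [heatKerHess, norm_smul, Real.norm_of_nonneg (heatKer_pos ht z).le]
  have h1 := mul_le_mul_of_nonneg_left
    (norm_slopeForm_le (by positivity : 0 ≤ 2 / t) (vSlope t z)) (heatKer_pos ht z).le
  have h2 := mul_le_mul_of_nonneg_right (heatKer_le ht z)
    (by positivity : 0 ≤ 2 / t * ‖innerCLM (KV d)‖)
  linarith [heatKer_mul_norm_vSlope_sq_le ht z]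

theorem continuous_heatKer_smul_vSlope (t : ℝ) :
    Continuous fun z : KSpace d => heatKer d t z • innerSL ℝ (vSlope t z) :=
  (continuous_heatKer t).smul ((innerSL ℝ).continuous.comp (continuous_vSlope t))

theorem continuous_heatKer_smul_xSlope (t : ℝ) :
    Continuous fun z : KSpace d => heatKer d t z • innerSL ℝ (xSlope t z) :=
  (continuous_heatKer t).smul ((innerSL ℝ).continuous.comp (continuous_xSlope t))

theorem continuous_heatKerHess (t : ℝ) : Continuous (heatKerHess (d := d) t) :=
  (continuous_heatKer t).smul ((continuous_slopeForm _).comp (continuous_vSlope t))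

theorem sum_heatKerHess_single {t : ℝ} (z : KSpace d) :
    ∑ i, heatKerHess t z (EuclideanSpace.single i 1) (EuclideanSpace.single i 1) =
      heatKer d t z * (‖vSlope t z‖ ^ 2 - 2 * d / t) := by
  simp [heatKerHess, slopeForm_apply, EuclideanSpace.real_norm_sq_eq, ← Finset.mul_sum,
    EuclideanSpace.inner_single_right, ← sq]
  left
  ring

section Derivatives

variable {f : KSpace d → ℝ} {t : ℝ}

theorem hasFDerivAt_kSemigroup_position (hf : Integrable f) (ht : 0 < t) (x v : KV d) :
    HasFDerivAt (fun x' => kSemigroup t f (x', v))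
      (∫ w, f w • heatKer d t (kShift t x v w) • innerSL ℝ (xSlope t (kShift t x v w))) x := by
  simp_rw [kSemigroup_eq ht]
  exact hasFDerivAt_integral_smul_of_bounded hf
    (fun x' => (continuous_heatKer t).comp (continuous_kShift t x' v))
    (fun w => norm_heatKer_le ht _)
    ((continuous_heatKer_smul_xSlope t).comp (continuous_kShift t x v))
    (fun x' w => norm_heatKer_smul_xSlope_le ht _)
    (fun x' w => hasFDerivAt_heatKer_position ht x' v w)

theorem hasFDerivAt_kSemigroup_velocity (hf : Integrable f) (ht : 0 < t) (x v : KV d) :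
    HasFDerivAt (fun v' => kSemigroup t f (x, v'))
      (∫ w, f w • heatKer d t (kShift t x v w) • innerSL ℝ (vSlope t (kShift t x v w))) v := by
  simp_rw [kSemigroup_eq ht]
  exact hasFDerivAt_integral_smul_of_bounded hf
    (fun v' => (continuous_heatKer t).comp (continuous_kShift t x v'))
    (fun w => norm_heatKer_le ht _)
    ((continuous_heatKer_smul_vSlope t).comp (continuous_kShift t x v))
    (fun v' w => norm_heatKer_smul_vSlope_le ht _)
    (fun v' w => hasFDerivAt_heatKer_velocity ht x v' w)

theorem hasFDerivAt_fderiv_kSemigroup_velocity (hf : Integrable f) (ht : 0 < t) (x v : KV d) :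
    HasFDerivAt (fun v' => fderiv ℝ (fun v'' => kSemigroup t f (x, v'')) v')
      (∫ w, f w • heatKerHess t (kShift t x v w)) v := by
  rw [funext fun v' => (hasFDerivAt_kSemigroup_velocity hf ht x v').fderiv]
  exact hasFDerivAt_integral_smul_of_bounded hf
    (K := fun v' w => heatKer d t (kShift t x v' w) • innerSL ℝ (vSlope t (kShift t x v' w)))
    (K' := fun v' w => heatKerHess t (kShift t x v' w))
    (fun v' => (continuous_heatKer_smul_vSlope t).comp (continuous_kShift t x v'))
    (fun w => norm_heatKer_smul_vSlope_le ht _)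
    ((continuous_heatKerHess t).comp (continuous_kShift t x v))
    (fun v' w => norm_heatKerHess_le ht _)
    (fun v' w => hasFDerivAt_heatKer_velocity_two ht x v' w)

theorem hasDerivAt_kSemigroup_time (hf : Integrable f) (ht : 0 < t) (x v : KV d) :
    HasDerivAt (fun τ => kSemigroup τ f (x, v))
      (∫ w, f w • (heatKer d t (kShift t x v w) * (‖vSlope t (kShift t x v w)‖ ^ 2 - 2 * d / t +
        ⟪xSlope t (kShift t x v w), v⟫))) t := by
  have hev : (fun τ => kSemigroup τ f (x, v)) =ᶠ[𝓝 t]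
      fun τ => ∫ w, f w • heatKer d τ (kShift τ x v w) := by
    filter_upwards [lt_mem_nhds ht] with τ hτ using kSemigroup_eq hτ f x v
  refine HasDerivAt.congr_of_eventuallyEq ?_ hev
  obtain ⟨s, hs, hst⟩ := exists_between ht
  set C := heatCoef d s * (4 / s) + heatCoef d s * (2 * d / s) +
    heatCoef d s * (1 + 12 / s ^ 3) * ‖v‖
  have hz := continuous_kShift t x v
  refine (hasDerivAt_integral_of_dominated_loc_of_deriv_le (bound := fun w => ‖f w‖ * C)
    (lt_mem_nhds hst)
    (.of_forall fun τ => hf.aestronglyMeasurable.smul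
      ((continuous_heatKer τ).comp (continuous_kShift τ x v)).aestronglyMeasurable)
    (integrable_smul_of_bounded hf ((continuous_heatKer t).comp hz)
      fun w => norm_heatKer_le ht _)
    (hf.aestronglyMeasurable.smul (Continuous.aestronglyMeasurable ?_))
    (.of_forall fun w τ hτ => ?_) (hf.norm.mul_const C)
    (.of_forall fun w τ hτ =>
      (hasDerivAt_heatKer_time (hs.trans hτ) x v w).const_smul (f w))).2
  · have h1 := (continuous_heatKer t).comp hz
    have h2 := (continuous_vSlope t).comp hz
    have h3 := (continuous_xSlope t).comp hz
    exact h1.mul (((h2.norm.pow 2).sub continuous_const).add (h3.inner continuous_const))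
  · rw [norm_smul]
    refine mul_le_mul_of_nonneg_left ?_ (norm_nonneg _)
    have hτ : s < τ := hτ
    have hτ0 := hs.trans hτ
    generalize kShift τ x v w = z
    have hp := heatKer_pos hτ0 z
    have hc := heatCoef_anti (d := d) hs hτ.le
    have hcs := heatCoef_pos (d := d) hs
    have b1 : heatKer d τ z * ‖vSlope τ z‖ ^ 2 ≤ heatCoef d s * (4 / s) :=
      (heatKer_mul_norm_vSlope_sq_le hτ0 z).trans (by gcongr)
    have b2 : heatKer d τ z * (2 * d / τ) ≤ heatCoef d s * (2 * d / s) := by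
      have := (heatKer_le hτ0 z).trans hc
      gcongr
    have b3 : heatKer d τ z * ‖xSlope τ z‖ ≤ heatCoef d s * (1 + 12 / s ^ 3) :=
      (heatKer_mul_norm_xSlope_le hτ0 z).trans (by gcongr)
    have b4 := mul_le_mul_of_nonneg_right b3 (norm_nonneg v)
    rw [norm_mul, Real.norm_of_nonneg hp.le]
    have b5 : ‖‖vSlope τ z‖ ^ 2 - 2 * d / τ + ⟪xSlope τ z, v⟫‖ ≤
        ‖vSlope τ z‖ ^ 2 + 2 * d / τ + ‖xSlope τ z‖ * ‖v‖ := by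
      refine (norm_add_le _ _).trans (add_le_add ((norm_sub_le _ _).trans_eq ?_)
        (norm_inner_le_norm _ _))
      rw [Real.norm_of_nonneg (by positivity), Real.norm_of_nonneg (by positivity)]
    have b6 := mul_le_mul_of_nonneg_left b5 hp.le
    linarith

end Derivatives

/-- equation \eqref{KE} of the paper. For every Schwartz
`f : ℝ^{2d} → ℝ`, the function `u(t,x,v) = P_t f(x,v)` satisfies the kinetic
Fokker–Planck equation: for every `t > 0` and `(x,v)`, `u` is differentiable in `x`,
twice differentiable in `v`, `∂_t u` exists, and
`∂_t u = Δ_v u + v·∇_x u`. -/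
theorem stmt16 (hd : 0 < d) (f : SchwartzMap (KSpace d) ℝ) :
    ∀ t : ℝ, 0 < t → ∀ x v : KV d,
      DifferentiableAt ℝ (fun x' : KV d => kSemigroup t (⇑f) (x', v)) x ∧
      DifferentiableAt ℝ (fun v' : KV d => kSemigroup t (⇑f) (x, v')) v ∧
      DifferentiableAt ℝ
        (fun v' : KV d => fderiv ℝ (fun v'' : KV d => kSemigroup t (⇑f) (x, v'')) v') v ∧
      HasDerivAt (fun τ : ℝ => kSemigroup τ (⇑f) (x, v))
        ((∑ i : Fin d,
            fderiv ℝ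
              (fun v' : KV d =>
                fderiv ℝ (fun v'' : KV d => kSemigroup t (⇑f) (x, v'')) v'
                  (EuclideanSpace.single i 1)) v (EuclideanSpace.single i 1)) +
          fderiv ℝ (fun x' : KV d => kSemigroup t (⇑f) (x', v)) x v) t := by
  intro t ht x v
  have hf : Integrable f := f.integrable
  have hx := hasFDerivAt_kSemigroup_position hf ht x v
  have hv := hasFDerivAt_fderiv_kSemigroup_velocity hf ht x v
  refine ⟨hx.differentiableAt, (hasFDerivAt_kSemigroup_velocity hf ht x v).differentiableAt,
    hv.differentiableAt, (hasDerivAt_kSemigroup_time hf ht x v).congr_deriv ?_⟩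
  have hz := continuous_kShift t x v
  have iH := integrable_smul_of_bounded hf (K := fun w => heatKerHess t (kShift t x v w))
    ((continuous_heatKerHess t).comp hz)
    fun w => norm_heatKerHess_le ht _
  have iX := integrable_smul_of_bounded hf
    (K := fun w => heatKer d t (kShift t x v w) • innerSL ℝ (xSlope t (kShift t x v w)))
    ((continuous_heatKer_smul_xSlope t).comp hz)
    fun w => norm_heatKer_smul_xSlope_le ht _
  have hH : ∀ i : Fin d, fderiv ℝ (fun v' : KV d =>
      fderiv ℝ (fun v'' : KV d => kSemigroup t f (x, v'')) v' (EuclideanSpace.single i 1)) v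
        (EuclideanSpace.single i 1) =
      ∫ w, (f w • heatKerHess t (kShift t x v w)) (EuclideanSpace.single i 1)
        (EuclideanSpace.single i 1) := by
    intro i
    rw [(hv.clm_apply (hasFDerivAt_const (EuclideanSpace.single i (1 : ℝ)) v)).fderiv]
    simp only [ContinuousLinearMap.comp_zero, zero_add, ContinuousLinearMap.flip_apply]
    rw [ContinuousLinearMap.integral_apply iH,
      ContinuousLinearMap.integral_apply (iH.apply_continuousLinearMap _)]
  rw [hx.fderiv, ContinuousLinearMap.integral_apply iX, Finset.sum_congr rfl fun i _ => hH i,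
    ← integral_finsetSum _ fun i _ =>
      (iH.apply_continuousLinearMap _).apply_continuousLinearMap _,
    ← integral_add (integrable_finsetSum _ fun i _ =>
      (iH.apply_continuousLinearMap _).apply_continuousLinearMap _)
      (iX.apply_continuousLinearMap _)]
  refine integral_congr_ae (.of_forall fun w => ?_)
  have h := sum_heatKerHess_single (t := t) (kShift t x v w)
  simp only [smul_apply, smul_eq_mul, innerSL_apply_apply] at h ⊢
  rw [← Finset.mul_sum, h]
  ring

end
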